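/- Let λ and μ be partitions and let m, θ be elements of a commutative ring R. Then the following product is unchanged when the two ranges of the products are interchanged: ∏_{(i,j)∈λ} (m + (λ_i − j) + 1 + θ(μ'_j − i)) · ∏_{(i,j)∈μ} (m − (μ_i − j) − θ(λ'_j − i + 1)) = ∏_{(i,j)∈μ} (m + (λ_i − j) + 1 + θ(μ'_j − i)) · ∏_{(i,j)∈λ} (m − (μ_i − j) − θ(λ'_j − i + 1)), where integers are mapped into R via the canonical ring map. (In arm/leg notation: ∏_{□∈λ}(m + a_λ(□)+1+θ l_μ(□)) ∏_{□∈μ}(m − a_μ(□) − θ(l_λ(□)+1)) is symmetric under interchanging the ranges □∈λ and □∈μ; this is the interchange property of the right-hand side of the Pieri-type formula for Jack polynomials.) -/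

import Mathlib

/-! Carlsson–Okounkov, "Exts and Vertex Operators": the product on the right-hand side of the Pieri-type formula for Jack polynomials is unchanged when the ranges `□ ∈ λ` and `□ ∈ μ` are interchanged. -/

open scoped BigOperators

/-- A partition, given by its (1-indexed) parts `p 1 ≥ p 2 ≥ ⋯ ≥ 0`, with finitely many
nonzero parts.  The value `p 0` is irrelevant. -/
def IsPartition (p : ℕ → ℕ) : Prop :=
  (∀ i j, 1 ≤ i → i ≤ j → p j ≤ p i) ∧ ∃ N, ∀ i, N ≤ i → p i = 0

/-- The Young diagram of `p`: the set of boxes `(i, j)` with `i ≥ 1` and `1 ≤ j ≤ p i`. -/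
def diagram (p : ℕ → ℕ) : Set (ℕ × ℕ) :=
  {x | 1 ≤ x.1 ∧ 1 ≤ x.2 ∧ x.2 ≤ p x.1}

/-- The conjugate partition: `conj p j = #{i ≥ 1 : p i ≥ j}`. -/
noncomputable def conj (p : ℕ → ℕ) (j : ℕ) : ℕ :=
  {i | 1 ≤ i ∧ j ≤ p i}.ncard

/-- Box `(i, j)` lies in the Young diagram of `p` iff it lies in its conjugate's. -/
theorem le_conj_iff {p : ℕ → ℕ} (hp : IsPartition p) {i j : ℕ} (hi : 1 ≤ i) (hj : 1 ≤ j) :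
    i ≤ conj p j ↔ j ≤ p i := by
  obtain ⟨hmono, N, hN⟩ := hp
  have hfin : {k | 1 ≤ k ∧ j ≤ p k}.Finite := by
    refine (Set.finite_Iio N).subset fun k hk => ?_
    by_contra h
    have := hN k (by simpa using h)
    have := hk.2
    omega
  constructor
  · intro h
    by_contra hlt
    have hsub : {k | 1 ≤ k ∧ j ≤ p k} ⊆ (Finset.Ico 1 i : Set ℕ) := by
      intro k hk
      have hk2 := hk.2
      have hki : k < i := by
        by_contra hik
        have := hmono i k hi (by omega)
        omega
      simpa using ⟨hk.1, hki⟩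
    have hcard := Set.ncard_le_ncard hsub (Finset.finite_toSet _)
    rw [Set.ncard_coe_finset, Nat.card_Ico] at hcard
    unfold conj at h
    omega
  · intro h
    have hsub : (Finset.Icc 1 i : Set ℕ) ⊆ {k | 1 ≤ k ∧ j ≤ p k} := by
      intro k hk
      have hk' : 1 ≤ k ∧ k ≤ i := by simpa using hk
      exact ⟨hk'.1, h.trans (hmono k i hk'.1 hk'.2)⟩
    have hcard := Set.ncard_le_ncard hsub hfin
    rw [Set.ncard_coe_finset, Nat.card_Icc] at hcard
    unfold conj
    omega

theorem finite_diagram {p : ℕ → ℕ} (hp : IsPartition p) : (diagram p).Finite := by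
  obtain ⟨hmono, N, hN⟩ := hp
  refine (Finset.finite_toSet (Finset.range N ×ˢ Finset.range (p 1 + 1))).subset ?_
  rintro ⟨i, j⟩ ⟨hi, hj, hij⟩
  simp only at hi hj hij
  have h1 := hmono 1 i le_rfl hi
  have h2 : i < N := by
    by_contra h
    have := hN i (by omega)
    omega
  simp
  omega

/-- A finite skew shape has as many north-east corners as south-west corners. -/
theorem card_northEast_eq_card_southWest (T : Finset (ℕ × ℕ))
    (hpos : ∀ x y, (x, y) ∈ T → 1 ≤ x ∧ 1 ≤ y)
    (hskew : ∀ x y, (x, y) ∈ T → (x + 1, y + 1) ∈ T → (x + 1, y) ∈ T ∧ (x, y + 1) ∈ T) :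
    {P ∈ T | (P.1 - 1, P.2) ∉ T ∧ (P.1, P.2 + 1) ∉ T}.card
      = {P ∈ T | (P.1, P.2 - 1) ∉ T ∧ (P.1 + 1, P.2) ∉ T}.card := by
  have hcount (p q : ℕ × ℕ → Prop) [DecidablePred p] [DecidablePred q] :
      {P ∈ T | ¬ p P ∧ ¬ q P}.card + (T.filter p).card + (T.filter q).card
        = T.card + {P ∈ T | p P ∧ q P}.card := by
    have h1 := Finset.card_union_add_card_inter (T.filter p) (T.filter q)
    rw [← Finset.filter_or, ← Finset.filter_and] at h1
    have h2 := Finset.card_filter_add_card_filter_not (s := T) (fun P => p P ∨ q P)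
    simp only [not_or] at h2
    omega
  have hne := hcount (fun P => (P.1 - 1, P.2) ∈ T) (fun P => (P.1, P.2 + 1) ∈ T)
  have hsw := hcount (fun P => (P.1, P.2 - 1) ∈ T) (fun P => (P.1 + 1, P.2) ∈ T)
  have hvert : {P ∈ T | (P.1 - 1, P.2) ∈ T}.card = {P ∈ T | (P.1 + 1, P.2) ∈ T}.card := by
    refine Finset.card_nbij' (fun P => (P.1 - 1, P.2)) (fun P => (P.1 + 1, P.2)) ?_ ?_ ?_ ?_ <;>
      rintro ⟨x, y⟩ h <;> simp only [Finset.coe_filter, Set.mem_ofPred_eq] at h ⊢ <;>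
      have := hpos _ _ h.1 <;> grind
  have hhor : {P ∈ T | (P.1, P.2 + 1) ∈ T}.card = {P ∈ T | (P.1, P.2 - 1) ∈ T}.card := by
    refine Finset.card_nbij' (fun P => (P.1, P.2 + 1)) (fun P => (P.1, P.2 - 1)) ?_ ?_ ?_ ?_ <;>
      rintro ⟨x, y⟩ h <;> simp only [Finset.coe_filter, Set.mem_ofPred_eq] at h ⊢ <;>
      have := hpos _ _ h.1 <;> grind
  have hboth : {P ∈ T | (P.1 - 1, P.2) ∈ T ∧ (P.1, P.2 + 1) ∈ T}.card
      = {P ∈ T | (P.1, P.2 - 1) ∈ T ∧ (P.1 + 1, P.2) ∈ T}.card := by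
    refine Finset.card_nbij' (fun P => (P.1 - 1, P.2 + 1)) (fun P => (P.1 + 1, P.2 - 1))
      ?_ ?_ ?_ ?_
    · rintro ⟨x, y⟩ h
      simp only [Finset.coe_filter, Set.mem_ofPred_eq] at h ⊢
      have := hpos _ _ h.1
      have := hskew (x - 1) y h.2.1
      grind
    · rintro ⟨x, y⟩ h
      simp only [Finset.coe_filter, Set.mem_ofPred_eq] at h ⊢
      have := hpos _ _ h.1
      have := hskew x (y - 1) h.2.1
      grind
    · rintro ⟨x, y⟩ h
      simp only [Finset.coe_filter, Set.mem_ofPred_eq] at h ⊢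
      have := hpos _ _ h.1
      grind
    · rintro ⟨x, y⟩ h
      simp only [Finset.coe_filter, Set.mem_ofPred_eq] at h ⊢
      have := hpos _ _ h.1
      grind
  omega

/-- In the shape `diagram lam \ diagram mu`, the pairs (boxes weakly to the right, boxes weakly
above) and the pairs (boxes weakly to the left, boxes weakly below) are equidistributed. -/
theorem card_right_above_eq_card_left_below {lam mu : ℕ → ℕ} (hlam : IsPartition lam)
    (hmu : IsPartition mu) (S : Finset (ℕ × ℕ))
    (hS : ∀ x, x ∈ S ↔ x ∈ diagram lam ∧ x ∉ diagram mu) (a l : ℤ) :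
    {x ∈ S | (lam x.1 : ℤ) - x.2 + 1 = a ∧ (x.1 : ℤ) - conj mu x.2 = l}.card
      = {x ∈ S | (x.2 : ℤ) - mu x.1 = a ∧ (conj lam x.2 : ℤ) - x.1 + 1 = l}.card := by
  classical
  have hS' (i j : ℕ) : (i, j) ∈ S ↔ 1 ≤ i ∧ 1 ≤ j ∧ j ≤ lam i ∧ mu i < j := by
    simp only [hS, diagram, Set.mem_ofPred_eq]
    grind
  by_cases hal : 1 ≤ a ∧ 1 ≤ l
  swap
  · rw [Finset.filter_false_of_mem, Finset.filter_false_of_mem]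
    · rintro ⟨i, j⟩ h
      obtain ⟨hi, hj, h1, h2⟩ := (hS' i j).1 h
      have := (le_conj_iff hlam hi hj).2 h1
      simp only
      omega
    · rintro ⟨i, j⟩ h
      obtain ⟨hi, hj, h1, h2⟩ := (hS' i j).1 h
      have := (le_conj_iff hmu hi hj).not.2 (by omega)
      simp only
      omega
  obtain ⟨b, rfl⟩ : ∃ b : ℕ, a = b + 1 := ⟨(a - 1).toNat, by omega⟩
  obtain ⟨k, rfl⟩ : ∃ k : ℕ, l = k + 1 := ⟨(l - 1).toNat, by omega⟩
  have hlm := hlam.1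
  have hmm := hmu.1
  have hTfin : {P : ℕ × ℕ | 1 ≤ P.1 ∧ 1 ≤ P.2 ∧ mu P.1 < P.2 ∧
      P.2 + b ≤ lam (P.1 + k)}.Finite := by
    refine (finite_diagram hlam).subset ?_
    rintro ⟨x, y⟩ ⟨hx, hy, -, h⟩
    have := hlm x (x + k) hx (by omega)
    simp only at hx hy h
    exact ⟨hx, hy, by simp only; omega⟩
  obtain ⟨T, hT⟩ : ∃ T : Finset (ℕ × ℕ), ∀ x y, (x, y) ∈ T ↔
      1 ≤ x ∧ 1 ≤ y ∧ mu x < y ∧ y + b ≤ lam (x + k) := ⟨hTfin.toFinset, by simp⟩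
  have hcorner := card_northEast_eq_card_southWest T
    (fun x y h => ⟨((hT x y).1 h).1, ((hT x y).1 h).2.1⟩) (fun x y h h' => by
      rw [hT] at h h'
      rw [hT, hT]
      have := hmm x (x + 1) h.1 (by omega)
      have := hlm (x + k) (x + 1 + k) (by omega) (by omega)
      omega)
  have hright : {x ∈ S | (lam x.1 : ℤ) - x.2 + 1 = b + 1 ∧ (x.1 : ℤ) - conj mu x.2 = k + 1}.card
      = {P ∈ T | (P.1 - 1, P.2) ∉ T ∧ (P.1, P.2 + 1) ∉ T}.card := by
    symm
    refine Finset.card_nbij' (fun P => (P.1 + k, P.2)) (fun x => (x.1 - k, x.2)) ?_ ?_ ?_ ?_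
    · rintro ⟨x, y⟩ h
      simp only [Finset.coe_filter, Set.mem_ofPred_eq, hT, hS'] at h ⊢
      obtain ⟨⟨hx, hy, h1, h2⟩, h3, h4⟩ := h
      have := hmm x (x + k) hx (by omega)
      have := (le_conj_iff hmu hx hy).not.2 (by omega)
      have : x - 1 ≤ conj mu y := by
        by_cases hx1 : x = 1
        · omega
        · rw [le_conj_iff hmu (by omega) hy]
          have := hlm (x - 1 + k) (x + k) (by omega) (by omega)
          omega
      omega
    · rintro ⟨i, j⟩ h
      simp only [Finset.coe_filter, Set.mem_ofPred_eq, hT, hS'] at h ⊢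
      obtain ⟨⟨hi, hj, h1, h2⟩, h3, h4⟩ := h
      have hik : i - k + k = i := by omega
      have := (le_conj_iff hmu (i := i - k) (by omega) hj).not.1 (by omega)
      have hup : 1 ≤ i - k - 1 → j ≤ mu (i - k - 1) := fun h =>
        (le_conj_iff hmu h hj).1 (by omega)
      rw [hik]
      omega
    · rintro ⟨x, y⟩ h
      simp
    · rintro ⟨i, j⟩ h
      simp only [Finset.coe_filter, Set.mem_ofPred_eq] at h
      simp only [Prod.mk.injEq, and_true]
      omega
  have hleft : {x ∈ S | (x.2 : ℤ) - mu x.1 = b + 1 ∧ (conj lam x.2 : ℤ) - x.1 + 1 = k + 1}.card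
      = {P ∈ T | (P.1, P.2 - 1) ∉ T ∧ (P.1 + 1, P.2) ∉ T}.card := by
    symm
    refine Finset.card_nbij' (fun P => (P.1, P.2 + b)) (fun x => (x.1, x.2 - b)) ?_ ?_ ?_ ?_
    · rintro ⟨x, y⟩ h
      simp only [Finset.coe_filter, Set.mem_ofPred_eq, hT, hS'] at h ⊢
      obtain ⟨⟨hx, hy, h1, h2⟩, h3, h4⟩ := h
      have := hmm x (x + 1) hx (by omega)
      have := hlm x (x + k) hx (by omega)
      have := (le_conj_iff hlam (i := x + k) (j := y + b) (by omega) (by omega)).2 h2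
      have := (le_conj_iff hlam (i := x + 1 + k) (j := y + b) (by omega) (by omega)).not.2
        (by omega)
      omega
    · rintro ⟨i, j⟩ h
      simp only [Finset.coe_filter, Set.mem_ofPred_eq, hT, hS'] at h ⊢
      obtain ⟨⟨hi, hj, h1, h2⟩, h3, h4⟩ := h
      have := (le_conj_iff hlam (i := i + k) (by omega) hj).1 (by omega)
      have := (le_conj_iff hlam (i := i + 1 + k) (by omega) hj).not.1 (by omega)
      omega
    · rintro ⟨x, y⟩ h
      simp
    · rintro ⟨i, j⟩ h
      simp only [Finset.coe_filter, Set.mem_ofPred_eq] at h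
      simp only [Prod.mk.injEq, true_and]
      omega
  rw [hright, hleft, hcorner]

theorem prod_right_above_eq_prod_left_below {M : Type*} [CommMonoid M] {lam mu : ℕ → ℕ}
    (hlam : IsPartition lam) (hmu : IsPartition mu) (S : Finset (ℕ × ℕ))
    (hS : ∀ x, x ∈ S ↔ x ∈ diagram lam ∧ x ∉ diagram mu) (f : ℤ × ℤ → M) :
    ∏ x ∈ S, f ((lam x.1 : ℤ) - x.2 + 1, (x.1 : ℤ) - conj mu x.2)
      = ∏ x ∈ S, f ((x.2 : ℤ) - mu x.1, (conj lam x.2 : ℤ) - x.1 + 1) := by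
  have h : S.val.map (fun x => ((lam x.1 : ℤ) - x.2 + 1, (x.1 : ℤ) - conj mu x.2))
      = S.val.map (fun x => ((x.2 : ℤ) - mu x.1, (conj lam x.2 : ℤ) - x.1 + 1)) := by
    ext ⟨a, l⟩
    have := card_right_above_eq_card_left_below hlam hmu S hS a l
    simp only [Multiset.count_map, Prod.mk.injEq]
    simp only [Finset.card, Finset.filter_val] at this
    simpa only [eq_comm] using this
  have h' := congrArg (fun s => (s.map f).prod) h
  simpa only [Multiset.map_map, Function.comp_def, Finset.prod] using h'

/-- `∏_{□∈λ}(m + a_λ(□) + 1 + θ l_μ(□)) · ∏_{□∈μ}(m − a_μ(□) − θ(l_λ(□)+1))` is symmetric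
under interchanging the two ranges of the products, where `a_λ(i,j) = λ_i − j` and
`l_λ(i,j) = λ'_j − i` (integers mapped into `R` by the canonical ring map). -/
theorem pieri_product_interchange {R : Type*} [CommRing R] (lam mu : ℕ → ℕ)
    (hlam : IsPartition lam) (hmu : IsPartition mu) (m θ : R) :
    (∏ᶠ x ∈ diagram lam,
        (m + (((lam x.1 : ℤ) - (x.2 : ℤ) : ℤ) : R) + 1
          + θ * (((conj mu x.2 : ℤ) - (x.1 : ℤ) : ℤ) : R)))
      * (∏ᶠ x ∈ diagram mu,
          (m - (((mu x.1 : ℤ) - (x.2 : ℤ) : ℤ) : R)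
            - θ * (((conj lam x.2 : ℤ) - (x.1 : ℤ) + 1 : ℤ) : R)))
      = (∏ᶠ x ∈ diagram mu,
          (m + (((lam x.1 : ℤ) - (x.2 : ℤ) : ℤ) : R) + 1
            + θ * (((conj mu x.2 : ℤ) - (x.1 : ℤ) : ℤ) : R)))
        * ∏ᶠ x ∈ diagram lam,
            (m - (((mu x.1 : ℤ) - (x.2 : ℤ) : ℤ) : R)
              - θ * (((conj lam x.2 : ℤ) - (x.1 : ℤ) + 1 : ℤ) : R)) := by
  classical
  obtain ⟨L, hL⟩ := (finite_diagram hlam).exists_finset_coe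
  obtain ⟨U, hU⟩ := (finite_diagram hmu).exists_finset_coe
  have hlm := prod_right_above_eq_prod_left_below hlam hmu (L \ U)
    (by simp [← hL, ← hU]) (fun z => m + (z.1 : R) - θ * (z.2 : R))
  have hml := prod_right_above_eq_prod_left_below hmu hlam (U \ L)
    (by simp [← hL, ← hU]) (fun z => m + ((1 - z.1 : ℤ) : R) - θ * ((1 - z.2 : ℤ) : R))
  rw [← hL, ← hU]
  simp only [finprod_mem_coe_finset]
  set F : ℕ × ℕ → R := fun x => m + (((lam x.1 : ℤ) - (x.2 : ℤ) : ℤ) : R) + 1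
    + θ * (((conj mu x.2 : ℤ) - (x.1 : ℤ) : ℤ) : R) with hF
  set G : ℕ × ℕ → R := fun x => m - (((mu x.1 : ℤ) - (x.2 : ℤ) : ℤ) : R)
    - θ * (((conj lam x.2 : ℤ) - (x.1 : ℤ) + 1 : ℤ) : R) with hG
  have hFG_lam : ∏ x ∈ L \ U, F x = ∏ x ∈ L \ U, G x := by
    convert hlm using 2 <;> simp only [hF, hG] <;> push_cast <;> ring
  have hFG_mu : ∏ x ∈ U \ L, G x = ∏ x ∈ U \ L, F x := by
    convert hml using 2 <;> simp only [hF, hG] <;> push_cast <;> ring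
  rw [← Finset.prod_inter_mul_prod_sdiff L U F, ← Finset.prod_inter_mul_prod_sdiff U L G,
    ← Finset.prod_inter_mul_prod_sdiff U L F, ← Finset.prod_inter_mul_prod_sdiff L U G,
    Finset.inter_comm U L, hFG_lam, hFG_mu]
  ring
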